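/- Let C and D be skeletally small abelian categories with Krull–Gabriel filtrations (C_n)_{n∈ℕ} and (D_n)_{n∈ℕ}, and let F : C → D be an exact functor. Assume that (i) for every object U of D there exist an object T of C and an epimorphism ε : F(T) → U, and (ii) for all T in C and n ∈ ℕ, T ∈ C_n implies F(T) ∈ D_n. Then KG(D) ≤ KG(C). -/

import Mathlib

open CategoryTheory Limits

universe v u v₂ u₂

namespace KGPaper

variable {C : Type u} [Category.{v} C] [Abelian C]

/-- A Serre subcategory of an abelian category, given as a predicate on objects:
it contains the zero objects and, for any short exact sequence, the middle term
satisfies the predicate iff the outer terms do. -/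
structure IsSerre {C : Type u} [Category.{v} C] [Abelian C] (P : C → Prop) : Prop where
  zero : ∀ X : C, IsZero X → P X
  ses : ∀ S : ShortComplex C, S.ShortExact → (P S.X₂ ↔ P S.X₁ ∧ P S.X₃)

/-- The class of `P`-isomorphisms: morphisms whose kernel and cokernel satisfy `P`.
The Gabriel quotient `C/P` is (2-universally) the localization of `C` at this class. -/
def serreW {C : Type u} [Category.{v} C] [Abelian C] (P : C → Prop) :
    MorphismProperty C :=
  fun _ _ f => P (kernel f) ∧ P (cokernel f)

/-- An object `T` is `P`-simple (`S`-simple for the Serre subcategory `S = P`) if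
`T ∉ P` and for every subobject `T'` of `T`, either `T' ∈ P` or `T/T' ∈ P`. -/
def IsRelSimple {C : Type u} [Category.{v} C] [Abelian C] (P : C → Prop) (T : C) : Prop :=
  ¬ P T ∧ ∀ T' : Subobject T, P (T' : C) ∨ P (cokernel T'.arrow)

/-- There is a chain of subobjects `0 = T₀ ⊆ T₁ ⊆ ... ⊆ Tₙ = T` all of whose successive
quotients `T_{i+1}/T_i` satisfy the predicate `Q`. -/
def HasChainWith {C : Type u} [Category.{v} C] [Abelian C] (Q : C → Prop) (T : C) : Prop :=
  ∃ (n : ℕ) (c : Fin (n + 1) → Subobject T) (hc : ∀ i : Fin n, c i.castSucc ≤ c i.succ),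
    c 0 = ⊥ ∧ c (Fin.last n) = ⊤ ∧
    ∀ i : Fin n, Q (cokernel (Subobject.ofLE _ _ (hc i)))

/-- An object of an abelian category has finite length if it has a composition series,
i.e. a finite chain of subobjects with simple successive quotients. -/
def FiniteLength {C : Type u} [Category.{v} C] [Abelian C] (T : C) : Prop :=
  HasChainWith (fun Z => Simple Z) T

end KGPaper

namespace KGPaper

/-- `T : C` becomes a simple object in the Gabriel quotient `C/P`: there is an
abelian category `D` together with an exact localization functor `q : C ⥤ D`
at the class of `P`-isomorphisms (this is, up to equivalence, the Gabriel
quotient together with its quotient functor) such that `q.obj T` is simple. -/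
def SimpleInQuotient {C : Type u} [Category.{v} C] [Abelian C] (P : C → Prop) (T : C) : Prop :=
  ∃ (D : Type (max u v)) (_ : Category.{max u v} D) (_ : Abelian D)
    (q : C ⥤ D) (_ : q.Additive) (_ : PreservesFiniteLimits q)
    (_ : PreservesFiniteColimits q) (_ : q.IsLocalization (serreW P)),
      Simple (q.obj T)

/-- `T : C` has finite length in the Gabriel quotient `C/P`. -/
def FiniteLengthInQuotient {C : Type u} [Category.{v} C] [Abelian C] (P : C → Prop)
    (T : C) : Prop :=
  ∃ (D : Type (max u v)) (_ : Category.{max u v} D) (_ : Abelian D)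
    (q : C ⥤ D) (_ : q.Additive) (_ : PreservesFiniteLimits q)
    (_ : PreservesFiniteColimits q) (_ : q.IsLocalization (serreW P)),
      FiniteLength (q.obj T)

/-- The Krull-Gabriel filtration of an abelian category `C`:
`C_{-1} = 0` (the zero objects) and `C_{n+1}` consists of the objects of finite
length in the Gabriel quotient `C/C_n`.  Here `kgFilt C n` is `C_n` for `n : ℕ`,
so `kgFilt C 0` consists of the objects of finite length in `C ≅ C/C_{-1}`. -/
def kgFilt (C : Type u) [Category.{v} C] [Abelian C] : ℕ → (C → Prop)
  | 0 => FiniteLengthInQuotient (fun X : C => IsZero X)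
  | n + 1 => FiniteLengthInQuotient (kgFilt C n)

/-- The Krull-Gabriel filtration indexed by `ℕ ∪ {-1}`, where the index `m : ℕ`
stands for `n = m - 1`; thus `kgFiltM C 0` is `C_{-1} = 0` and
`kgFiltM C (n+1)` is `C_n`. -/
def kgFiltM (C : Type u) [Category.{v} C] [Abelian C] : ℕ → (C → Prop)
  | 0 => fun X : C => IsZero X
  | n + 1 => kgFilt C n

/-- The Krull-Gabriel dimension of an abelian category `C`: the least `n : ℕ` with
`C_n = C` if such an `n` exists, and `∞` (here `⊤ : ℕ∞`) otherwise. -/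
noncomputable def kgDim (C : Type u) [Category.{v} C] [Abelian C] : ℕ∞ :=
  sInf ((fun m : ℕ => (m : ℕ∞)) '' { m : ℕ | ∀ T : C, kgFilt C m T })

end KGPaper

namespace KGPaper

/-- One step of a composition series. -/
def SimpleStep {A : Type u} [Category.{v} A] [Abelian A] {X : A} (a b : Subobject X) : Prop :=
  ∃ h : a ≤ b, Simple (cokernel (Subobject.ofLE a b h))

theorem chain_of_reflTransGen {A : Type u} [Category.{v} A] [Abelian A] {X : A}
    {a b : Subobject X} (h : Relation.ReflTransGen SimpleStep a b) :
    ∃ p : RelSeries {x : Subobject X × Subobject X | SimpleStep x.1 x.2},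
      p.head = a ∧ p.last = b := by
  induction h with
  | refl => exact ⟨RelSeries.singleton _ a, rfl, rfl⟩
  | @tail b c _ hbc ih =>
    obtain ⟨p, hp, hq⟩ := ih
    refine ⟨p.snoc c ?_, ?_, ?_⟩
    · rw [hq]; exact hbc
    · rw [RelSeries.head_snoc, hp]
    · rw [RelSeries.last_snoc]

theorem step_image {A : Type u} [Category.{v} A] [Abelian A] {X Y : A} (f : X ⟶ Y)
    {a b : Subobject X} (hab : a ≤ b) (hs : Simple (cokernel (Subobject.ofLE a b hab))) :
    Relation.ReflTransGen SimpleStep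
      (imageSubobject (a.arrow ≫ f)) (imageSubobject (b.arrow ≫ f)) := by
  have hle : imageSubobject (a.arrow ≫ f) ≤ imageSubobject (b.arrow ≫ f) := by
    have := imageSubobject_comp_le (Subobject.ofLE a b hab) (b.arrow ≫ f)
    simpa using this
  let φ : cokernel (Subobject.ofLE a b hab) ⟶ cokernel (Subobject.ofLE _ _ hle) :=
    cokernel.map _ _ (factorThruImageSubobject (a.arrow ≫ f))
      (factorThruImageSubobject (b.arrow ≫ f)) (by
        rw [← cancel_mono (imageSubobject (b.arrow ≫ f)).arrow]
        simp)
  have hφ : cokernel.π _ ≫ φ = factorThruImageSubobject (b.arrow ≫ f) ≫ cokernel.π _ :=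
    cokernel.π_desc _ _ _
  have : Epi (cokernel.π (Subobject.ofLE a b hab) ≫ φ) := by rw [hφ]; infer_instance
  have : Epi φ := epi_of_epi (cokernel.π (Subobject.ofLE a b hab)) φ
  by_cases h0 : φ = 0
  · have hz : cokernel.π (Subobject.ofLE _ _ hle) = 0 := by
      rw [← cancel_epi (factorThruImageSubobject (b.arrow ≫ f)), ← hφ, h0]; simp
    have : Epi (Subobject.ofLE _ _ hle) := Preadditive.epi_of_cokernel_zero hz
    have : IsIso (Subobject.ofLE _ _ hle) := isIso_of_mono_of_epi _
    have hge : imageSubobject (b.arrow ≫ f) ≤ imageSubobject (a.arrow ≫ f) :=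
      Subobject.le_of_comm (inv (Subobject.ofLE _ _ hle)) (by simp)
    rw [le_antisymm hle hge]
  · have := mono_of_nonzero_from_simple h0
    have : IsIso φ := isIso_of_mono_of_epi _
    exact .single ⟨hle, Simple.of_iso (asIso φ).symm⟩

theorem finiteLength_of_epi {A : Type u} [Category.{v} A] [Abelian A] {X Y : A} (f : X ⟶ Y)
    [Epi f] (h : FiniteLength X) : FiniteLength Y := by
  obtain ⟨n, c, hc, h0, h1, hs⟩ := h
  have key : ∀ i : Fin (n + 1), Relation.ReflTransGen SimpleStep
      (imageSubobject ((c 0).arrow ≫ f)) (imageSubobject ((c i).arrow ≫ f)) := by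
    intro i
    induction i using Fin.induction with
    | zero => exact .refl
    | succ i ih => exact ih.trans (step_image f (hc i) (hs i))
  have k := key (Fin.last n)
  have e0 : imageSubobject ((c 0).arrow ≫ f) = ⊥ := by
    rw [h0, Subobject.bot_arrow, zero_comp, imageSubobject_zero]
  have e1 : imageSubobject ((c (Fin.last n)).arrow ≫ f) = ⊤ := by
    rw [h1]
    have : Epi (imageSubobject ((⊤ : Subobject X).arrow ≫ f)).arrow := by
      apply epi_of_epi_fac (imageSubobject_arrow_comp ((⊤ : Subobject X).arrow ≫ f))
    have : IsIso (imageSubobject ((⊤ : Subobject X).arrow ≫ f)).arrow := isIso_of_mono_of_epi _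
    exact Subobject.eq_top_of_isIso_arrow _
  rw [e0, e1] at k
  obtain ⟨p, hp, hq⟩ := chain_of_reflTransGen k
  exact ⟨p.length, p.toFun, fun i => (p.step i).1, hp, hq, fun i => (p.step i).2⟩

theorem finiteLengthInQuotient_of_epi {A : Type u} [Category.{v} A] [Abelian A] {P : A → Prop}
    {X Y : A} (f : X ⟶ Y) [Epi f] (h : FiniteLengthInQuotient P X) :
    FiniteLengthInQuotient P Y := by
  obtain ⟨B, i1, i2, q, i3, i4, i5, i6, h⟩ := h
  exact ⟨B, i1, i2, q, i3, i4, i5, i6, finiteLength_of_epi (q.map f) h⟩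

theorem kgFilt_of_epi {A : Type u} [Category.{v} A] [Abelian A] {n : ℕ}
    {X Y : A} (f : X ⟶ Y) [Epi f] (h : kgFilt A n X) : kgFilt A n Y := by
  cases n with
  | zero => exact finiteLengthInQuotient_of_epi f h
  | succ n => exact finiteLengthInQuotient_of_epi f h

/-- Let `C`, `D` be skeletally small abelian categories with
Krull-Gabriel filtrations `(C_n)`, `(D_n)` and let `F : C ⥤ D` be an exact functor.
Assume (i) every object `U` of `D` admits an epimorphism `ε : F(T) → U` with `T` in
`C`, and (ii) `T ∈ C_n` implies `F(T) ∈ D_n` for all `T` and `n`.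
Then `KG(D) ≤ KG(C)`. -/
theorem kgDim_le_of_exact_functor
    {C : Type u} [Category.{v} C] [Abelian C] [EssentiallySmall.{v} C]
    {D : Type u₂} [Category.{v₂} D] [Abelian D] [EssentiallySmall.{v₂} D]
    (F : C ⥤ D) [F.Additive] [PreservesFiniteLimits F] [PreservesFiniteColimits F]
    (hsurj : ∀ U : D, ∃ (T : C) (ε : F.obj T ⟶ U), Epi ε)
    (hpres : ∀ (T : C) (n : ℕ), kgFilt C n T → kgFilt D n (F.obj T)) :
    kgDim D ≤ kgDim C := by
  apply sInf_le_sInf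
  apply Set.image_mono
  intro m hm U
  obtain ⟨T, ε, hε⟩ := hsurj U
  exact kgFilt_of_epi ε (hpres T m (hm T))

end KGPaper
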